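/- Let g_i : ℝ^{d_x} × ℝ^{d_y} → ℝ (i = 1,…,n) be L₂-smooth with L₂ > 0, let G := (1/n)∑_{i=1}^n g_i, let γ ∈ (0, 1/(2L₂)), set η := 1/γ − L₂ > 0, and assume the proximal solution map θ*_γ is L_θ-Lipschitz on ℝ^{d_x} × ℝ^{d_y}. Let (x_i)_{i=1}^n, (y_i)_{i=1}^n, (θ_i)_{i=1}^n be families of vectors with averages x̄, ȳ, θ̄, let T := (1/n)∑_{i=1}^n ( ∇_y g_i(x_i,θ_i) + (θ_i − y_i)/γ ), let λ ≥ 0 and δ > 0, let θ̄⁺ := θ̄ − λT, and let x̄⁺ ∈ ℝ^{d_x}, ȳ⁺ ∈ ℝ^{d_y} be arbitrary. Then ‖θ̄⁺ − θ*_γ(x̄⁺,ȳ⁺)‖² ≤ (1+δ)( ‖θ̄ − θ*_γ(x̄,ȳ)‖² + λ²‖T‖² + λ(6/η)L₂² Δ_x + λ(6/η)(1/γ²) Δ_y + λ(6/η)(L₂² + 1/γ²) Δ_θ − ηλ‖θ̄ − θ*_γ(x̄,ȳ)‖² ) + 2L_θ²(1 + 1/δ)( ‖x̄⁺ − x̄‖²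 + ‖ȳ⁺ − ȳ‖² ). -/

import Mathlib

open scoped RealInnerProductSpace

noncomputable section

/-- `Euc d` is the Euclidean space `ℝ^d`. -/
abbrev Euc (d : ℕ) : Type := EuclideanSpace ℝ (Fin d)

/-- Gradient of `h` with respect to the first block of variables. -/
noncomputable def gradx {dx dy : ℕ} (h : Euc dx → Euc dy → ℝ) (x : Euc dx) (y : Euc dy) :
    Euc dx :=
  gradient (fun x' => h x' y) x

/-- Gradient of `h` with respect to the second block of variables. -/
noncomputable def grady {dx dy : ℕ} (h : Euc dx → Euc dy → ℝ) (x : Euc dx) (y : Euc dy) :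
    Euc dy :=
  gradient (fun y' => h x y') y

/-- The ℓ²-norm of a pair of vectors (the norm on the product `ℝ^{d_x} × ℝ^{d_y}`). -/
noncomputable def pnorm {dx dy : ℕ} (a : Euc dx) (b : Euc dy) : ℝ :=
  Real.sqrt (‖a‖ ^ 2 + ‖b‖ ^ 2)

/-- `h : ℝ^{d_x} × ℝ^{d_y} → ℝ` is `L`-smooth: it is differentiable and its gradient is
`L`-Lipschitz with respect to the ℓ² product norm. -/
def LSmooth {dx dy : ℕ} (L : ℝ) (h : Euc dx → Euc dy → ℝ) : Prop :=
  (∀ y, Differentiable ℝ fun x => h x y) ∧ (∀ x, Differentiable ℝ fun y => h x y) ∧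
    ∀ x y x' y',
      pnorm (gradx h x y - gradx h x' y') (grady h x y - grady h x' y') ≤
        L * pnorm (x - x') (y - y')

/-- The Moreau envelope `V_γ` of `G`. -/
noncomputable def moreau {dx dy : ℕ} (G : Euc dx → Euc dy → ℝ) (γ : ℝ)
    (x : Euc dx) (y : Euc dy) : ℝ :=
  ⨅ θ : Euc dy, (G x θ + ‖θ - y‖ ^ 2 / (2 * γ))

/-- The average `(1/n) ∑ᵢ vᵢ` of a family of vectors. -/
noncomputable def avg {n : ℕ} {V : Type} [AddCommGroup V] [Module ℝ V] (v : Fin n → V) : V :=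
  (n : ℝ)⁻¹ • ∑ i, v i

/-- The mean squared deviation `(1/n) ∑ᵢ ‖vᵢ − v̄‖²` of a family of vectors. -/
noncomputable def devSq {n d : ℕ} (v : Fin n → Euc d) : ℝ :=
  (n : ℝ)⁻¹ * ∑ i, ‖v i - avg v‖ ^ 2

theorem pnorm_sq {dx dy : ℕ} (a : Euc dx) (b : Euc dy) :
    pnorm a b ^ 2 = ‖a‖ ^ 2 + ‖b‖ ^ 2 :=
  Real.sq_sqrt (by positivity)

theorem norm_le_pnorm_right {dx dy : ℕ} (a : Euc dx) (b : Euc dy) : ‖b‖ ≤ pnorm a b :=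
  Real.le_sqrt_of_sq_le (by nlinarith [sq_nonneg ‖a‖])

theorem LSmooth.norm_grady_sub_le {dx dy : ℕ} {L : ℝ} {h : Euc dx → Euc dy → ℝ}
    (hh : LSmooth L h) (x x' : Euc dx) (y y' : Euc dy) :
    ‖grady h x y - grady h x' y'‖ ≤ L * pnorm (x - x') (y - y') :=
  (norm_le_pnorm_right _ _).trans (hh.2.2 x y x' y')

theorem LSmooth.norm_grady_sub_sq_le {dx dy : ℕ} {L : ℝ} {h : Euc dx → Euc dy → ℝ}
    (hh : LSmooth L h) (x x' : Euc dx) (y y' : Euc dy) :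
    ‖grady h x y - grady h x' y'‖ ^ 2 ≤ L ^ 2 * (‖x - x'‖ ^ 2 + ‖y - y'‖ ^ 2) := by
  rw [← pnorm_sq, ← mul_pow]
  exact pow_le_pow_left₀ (norm_nonneg _) (hh.norm_grady_sub_le x x' y y') 2

/-- The gradient of an `L`-smooth function in its second block is `-L`-monotone. -/
theorem LSmooth.neg_mul_le_inner_grady_sub {dx dy : ℕ} {L : ℝ} {h : Euc dx → Euc dy → ℝ}
    (hh : LSmooth L h) (x : Euc dx) (y y' : Euc dy) :
    -(L * ‖y - y'‖ ^ 2) ≤ ⟪grady h x y - grady h x y', y - y'⟫ := by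
  have h1 := hh.norm_grady_sub_le x x y y'
  have h2 : pnorm (x - x) (y - y') = ‖y - y'‖ := by simp [pnorm]
  rw [h2] at h1
  have h3 := neg_le_of_abs_le (abs_real_inner_le_norm (grady h x y - grady h x y') (y - y'))
  nlinarith [mul_le_mul_of_nonneg_right h1 (norm_nonneg (y - y'))]

theorem LSmooth.hasFDerivAt_right {dx dy : ℕ} {L : ℝ} {h : Euc dx → Euc dy → ℝ}
    (hh : LSmooth L h) (x : Euc dx) (y : Euc dy) :
    HasFDerivAt (fun y' => h x y') (innerSL ℝ (grady h x y)) y :=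
  (hh.2.1 x y).hasGradientAt.hasFDerivAt

/-- First-order optimality condition for the proximal problem of an average. -/
theorem avg_grady_add_smul_eq_zero_of_isMin {dx dy n : ℕ} {L γ : ℝ} (hγ : 0 < γ)
    {g : Fin n → Euc dx → Euc dy → ℝ} (hg : ∀ i, LSmooth L (g i))
    (x : Euc dx) (y θ₀ : Euc dy)
    (hmin : ∀ θ, (n : ℝ)⁻¹ * ∑ i, g i x θ₀ + ‖θ₀ - y‖ ^ 2 / (2 * γ) ≤
      (n : ℝ)⁻¹ * ∑ i, g i x θ + ‖θ - y‖ ^ 2 / (2 * γ)) :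
    (n : ℝ)⁻¹ • ∑ i, grady (g i) x θ₀ + γ⁻¹ • (θ₀ - y) = 0 := by
  have h1 : HasFDerivAt (fun θ => ∑ i, g i x θ) (∑ i, innerSL ℝ (grady (g i) x θ₀)) θ₀ :=
    HasFDerivAt.fun_sum fun i _ => (hg i).hasFDerivAt_right x θ₀
  have h2 := ((hasFDerivAt_id (𝕜 := ℝ) θ₀).sub_const y).norm_sq.mul_const (2 * γ)⁻¹
  have h3 := (h1.const_mul (n : ℝ)⁻¹).add h2
  have h4 : IsLocalMin ((fun θ => (n : ℝ)⁻¹ * ∑ i, g i x θ) +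
      fun θ => ‖id θ - y‖ ^ 2 * (2 * γ)⁻¹) θ₀ :=
    Filter.Eventually.of_forall fun θ => by simpa [div_eq_mul_inv] using hmin θ
  have h5 := h4.hasFDerivAt_eq_zero h3
  refine ext_inner_right ℝ fun v => ?_
  have h6 := congrArg (fun f => f v) h5
  simp only [id_eq, add_apply, smul_apply, sum_apply, innerSL_apply_apply,
    ContinuousLinearMap.comp_apply, ContinuousLinearMap.id_apply, zero_apply,
    smul_eq_mul, nsmul_eq_mul] at h6
  simp only [inner_add_left, real_inner_smul_left, sum_inner, inner_zero_left]
  rw [← h6]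
  push_cast
  field_simp

/-- Jensen's inequality for the squared norm of an average. -/
theorem norm_avg_sq_le {n d : ℕ} (v : Fin n → Euc d) :
    ‖avg v‖ ^ 2 ≤ (n : ℝ)⁻¹ * ∑ i, ‖v i‖ ^ 2 := by
  rcases Nat.eq_zero_or_pos n with rfl | hn
  · simp [avg]
  have hn' : (0 : ℝ) < n := by exact_mod_cast hn
  have h1 : ‖∑ i, v i‖ ^ 2 ≤ n * ∑ i, ‖v i‖ ^ 2 := by
    refine (pow_le_pow_left₀ (norm_nonneg _) (norm_sum_le _ _) 2).trans ?_
    simpa using sq_sum_le_card_mul_sum_sq (s := Finset.univ) (f := fun i => ‖v i‖)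
  rw [avg, norm_smul, mul_pow, norm_inv, Real.norm_natCast]
  calc ((n : ℝ)⁻¹) ^ 2 * ‖∑ i, v i‖ ^ 2
      ≤ ((n : ℝ)⁻¹) ^ 2 * (n * ∑ i, ‖v i‖ ^ 2) := by gcongr
    _ = _ := by field_simp

theorem norm_add_sq_le_mul_add_mul {E : Type*} [NormedAddCommGroup E] {δ : ℝ} (hδ : 0 < δ)
    (a b : E) : ‖a + b‖ ^ 2 ≤ (1 + δ) * ‖a‖ ^ 2 + (1 + 1 / δ) * ‖b‖ ^ 2 := by
  have h1 := pow_le_pow_left₀ (norm_nonneg _) (norm_add_le a b) 2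
  have h2 : (1 + δ) * ‖a‖ ^ 2 + (1 + 1 / δ) * ‖b‖ ^ 2 - (‖a‖ + ‖b‖) ^ 2 =
      (δ * ‖a‖ - ‖b‖) ^ 2 / δ := by
    field_simp
    ring
  have h3 : 0 ≤ (δ * ‖a‖ - ‖b‖) ^ 2 / δ := by positivity
  linarith

theorem devSq_nonneg {n d : ℕ} (v : Fin n → Euc d) : 0 ≤ devSq v := by
  unfold devSq
  positivity

/-- A step along a perturbation `p + r` of an `η`-strongly monotone direction `p`. -/
theorem norm_sub_smul_add_sq_le {E : Type*} [NormedAddCommGroup E] [InnerProductSpace ℝ E]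
    {η lam : ℝ} (hη : 0 < η) (hlam : 0 ≤ lam) (e p r : E) (hp : η * ‖e‖ ^ 2 ≤ ⟪p, e⟫) :
    ‖e - lam • (p + r)‖ ^ 2 ≤
      ‖e‖ ^ 2 + lam ^ 2 * ‖p + r‖ ^ 2 + lam * (1 / η) * ‖r‖ ^ 2 - η * lam * ‖e‖ ^ 2 := by
  have h1 : ‖e - lam • (p + r)‖ ^ 2 =
      ‖e‖ ^ 2 - 2 * lam * (⟪p, e⟫ + ⟪r, e⟫) + lam ^ 2 * ‖p + r‖ ^ 2 := by
    rw [norm_sub_sq_real, real_inner_smul_right, norm_smul, mul_pow, Real.norm_eq_abs, sq_abs,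
      real_inner_comm, inner_add_left]
    ring
  have h2 := neg_le_of_abs_le (abs_real_inner_le_norm r e)
  have h3 : 1 / η * ‖r‖ ^ 2 + η * ‖e‖ ^ 2 - 2 * (‖r‖ * ‖e‖) = (‖r‖ - η * ‖e‖) ^ 2 / η := by
    field_simp
    ring
  have h4 : 0 ≤ (‖r‖ - η * ‖e‖) ^ 2 / η := by positivity
  have h5 : 0 ≤ lam * (1 / η * ‖r‖ ^ 2 - η * ‖e‖ ^ 2 + 2 * (⟪p, e⟫ + ⟪r, e⟫)) :=
    mul_nonneg hlam (by linarith)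
  rw [h1]
  linarith

/-- one-step recursion for the proximal tracking error.  Here `G = (1/n)∑ gᵢ`,
`θs` is the proximal solution map of `G` (the unique minimizer characterized by `hθs`),
assumed `L_θ`-Lipschitz, `η = 1/γ − L₂ > 0`, `T` is the averaged `θ`-direction,
`θ̄⁺ = θ̄ − λT`, and `x̄⁺, ȳ⁺` are arbitrary. -/
theorem prox_tracking_error_recursion {dx dy n : ℕ} (hn : 0 < n) (L₂ γ η Lθ lam δ : ℝ)
    (hL₂ : 0 < L₂) (hγ0 : 0 < γ) (hγ : γ < 1 / (2 * L₂))
    (hη : η = 1 / γ - L₂) (hη0 : 0 < η)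
    (g : Fin n → Euc dx → Euc dy → ℝ)
    (hg : ∀ i, LSmooth L₂ (g i))
    (G : Euc dx → Euc dy → ℝ)
    (hG : G = fun a b => (n : ℝ)⁻¹ * ∑ i, g i a b)
    (θs : Euc dx → Euc dy → Euc dy)
    (hθs : ∀ x y θ, θ ≠ θs x y →
      G x (θs x y) + ‖θs x y - y‖ ^ 2 / (2 * γ) < G x θ + ‖θ - y‖ ^ 2 / (2 * γ))
    (hLip : ∀ (x x' : Euc dx) (y y' : Euc dy),
      ‖θs x y - θs x' y'‖ ≤ Lθ * pnorm (x - x') (y - y'))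
    (hlam : 0 ≤ lam) (hδ : 0 < δ)
    (xv : Fin n → Euc dx) (yv θv : Fin n → Euc dy)
    (T : Euc dy)
    (hT : T = (n : ℝ)⁻¹ • ∑ i, (grady (g i) (xv i) (θv i) + γ⁻¹ • (θv i - yv i)))
    (xp : Euc dx) (yp : Euc dy) :
    ‖(avg θv - lam • T) - θs xp yp‖ ^ 2 ≤
      (1 + δ) * (‖avg θv - θs (avg xv) (avg yv)‖ ^ 2 + lam ^ 2 * ‖T‖ ^ 2 +
          lam * (6 / η) * L₂ ^ 2 * devSq xv +
          lam * (6 / η) * (1 / γ ^ 2) * devSq yv +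
          lam * (6 / η) * (L₂ ^ 2 + 1 / γ ^ 2) * devSq θv -
          η * lam * ‖avg θv - θs (avg xv) (avg yv)‖ ^ 2) +
        2 * Lθ ^ 2 * (1 + 1 / δ) * (‖xp - avg xv‖ ^ 2 + ‖yp - avg yv‖ ^ 2) := by
  have hn' : (n : ℝ) ≠ 0 := by exact_mod_cast hn.ne'
  subst hG
  set s := θs (avg xv) (avg yv) with hs
  set e := avg θv - s with he
  have hopt : (n : ℝ)⁻¹ • ∑ i, grady (g i) (avg xv) s + γ⁻¹ • (s - avg yv) = 0 := by
    refine avg_grady_add_smul_eq_zero_of_isMin hγ0 hg _ _ _ fun θ => ?_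
    by_cases h : θ = s
    · rw [h]
    · exact (hθs (avg xv) (avg yv) θ h).le
  set p := avg (fun i => grady (g i) (avg xv) (avg θv) - grady (g i) (avg xv) s) + γ⁻¹ • e
    with hp
  set r := avg fun i => grady (g i) (xv i) (θv i) - grady (g i) (avg xv) (avg θv) with hr
  have hTpr : T = p + r := by
    rw [hT, ← sub_zero ((n : ℝ)⁻¹ • _), ← hopt, hp, hr, he]
    simp only [avg, Finset.sum_add_distrib, Finset.sum_sub_distrib, ← Finset.smul_sum]
    module
  have hmono : η * ‖e‖ ^ 2 ≤ ⟪p, e⟫ := by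
    have h1 : ∑ _i : Fin n, -(L₂ * ‖e‖ ^ 2) ≤
        ∑ i, ⟪grady (g i) (avg xv) (avg θv) - grady (g i) (avg xv) s, e⟫ :=
      Finset.sum_le_sum fun i _ => (hg i).neg_mul_le_inner_grady_sub _ _ _
    have h2 := mul_le_mul_of_nonneg_left h1 (by positivity : (0 : ℝ) ≤ (n : ℝ)⁻¹)
    rw [Finset.sum_const, Finset.card_univ, Fintype.card_fin, nsmul_eq_mul,
      inv_mul_cancel_left₀ hn'] at h2
    rw [hp, inner_add_left, real_inner_smul_left, real_inner_self_eq_norm_sq, avg,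
      real_inner_smul_left, sum_inner, hη, one_div]
    linarith
  have hrsq : ‖r‖ ^ 2 ≤ L₂ ^ 2 * (devSq xv + devSq θv) := by
    refine (norm_avg_sq_le _).trans ?_
    rw [devSq, devSq, ← mul_add, ← Finset.sum_add_distrib, mul_left_comm, Finset.mul_sum _ _ (L₂ ^ 2)]
    gcongr with i
    exact (hg i).norm_grady_sub_sq_le _ _ _ _
  have hstep := norm_sub_smul_add_sq_le hη0 hlam e p r hmono
  rw [← hTpr] at hstep
  have hdrift : ‖s - θs xp yp‖ ^ 2 ≤ Lθ ^ 2 * (‖xp - avg xv‖ ^ 2 + ‖yp - avg yv‖ ^ 2) := by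
    rw [← pnorm_sq, ← mul_pow, norm_sub_rev]
    exact pow_le_pow_left₀ (norm_nonneg _) (hLip _ _ _ _) 2
  have hsplit := norm_add_sq_le_mul_add_mul hδ (e - lam • T) (s - θs xp yp)
  rw [show e - lam • T + (s - θs xp yp) = avg θv - lam • T - θs xp yp by rw [he]; abel]
    at hsplit
  have hx := devSq_nonneg xv
  have hy := devSq_nonneg yv
  have hθ := devSq_nonneg θv
  have hvar : lam * (1 / η) * ‖r‖ ^ 2 ≤ lam * (6 / η) * L₂ ^ 2 * devSq xv +
      lam * (6 / η) * (1 / γ ^ 2) * devSq yv +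
      lam * (6 / η) * (L₂ ^ 2 + 1 / γ ^ 2) * devSq θv := by
    have h1 : lam * (1 / η) * ‖r‖ ^ 2 ≤
        lam * (1 / η) * (L₂ ^ 2 * (devSq xv + devSq θv)) := by gcongr
    have h2 : 0 ≤ lam * (1 / η) * (5 * L₂ ^ 2 * (devSq xv + devSq θv) +
        6 * (1 / γ ^ 2) * (devSq yv + devSq θv)) := by positivity
    rw [show (6 : ℝ) / η = 6 * (1 / η) by ring]
    linarith
  refine hsplit.trans (add_le_add (mul_le_mul_of_nonneg_left (by linarith) (by positivity)) ?_)
  calc (1 + 1 / δ) * ‖s - θs xp yp‖ ^ 2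
      ≤ (1 + 1 / δ) * (Lθ ^ 2 * (‖xp - avg xv‖ ^ 2 + ‖yp - avg yv‖ ^ 2)) := by gcongr
    _ ≤ 2 * Lθ ^ 2 * (1 + 1 / δ) * (‖xp - avg xv‖ ^ 2 + ‖yp - avg yv‖ ^ 2) := by
      have : 0 ≤ Lθ ^ 2 * (1 + 1 / δ) * (‖xp - avg xv‖ ^ 2 + ‖yp - avg yv‖ ^ 2) := by
        positivity
      linarith
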